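/- arXiv:2512.13549 — 7 statements merged into one kernel-verified Lean document; each statement's English description precedes it below -/
import Mathlib

section
/- Let r₁, r₂, C be real constants and let Δ : ℝ → ℝ be differentiable. Define z₁(t) = −2Δ(t) + 2C and z₂(t) = 2Δ(t) − C, and assume that for all t ∈ ℝ: 8(r₁² − z₁(t)²)(r₂² − z₂(t)²) = 16 (z₁'(t))² + (4 − (r₁² − z₁(t)²) − 2(r₂² − z₂(t)²))². Then for all t ∈ ℝ, (1/2)(Δ'(t))² + V(Δ(t)) = 0, where V(Δ) = (1/8)Δ⁴ + c₂Δ² + c₁Δ + c₀ with c₂ = (−2C² + r₁² − 2r₂² + 12)/16, c₁ = −C, and c₀ = ((6C² − r₁² − 2r₂² + 4)² − 8(4C² − r₁²)(C² − r₂²))/128. In other words, the detuning Δ evolves like the position of a classical particle of unit mass and zero total energy in the quartic potential V. -/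
/-- For normal extremals with `N = 2` two-level systems, the conservation-law relation
(Eq. wcjkw) implies that the detuning `Δ` evolves like a classical particle of unit mass
and zero total energy in a quartic potential `V`. -/
theorem detuning_quartic_potential
    (r₁ r₂ C : ℝ) (Δ z₁ z₂ : ℝ → ℝ)
    (hΔ : Differentiable ℝ Δ)
    (hz₁ : ∀ t, z₁ t = -2 * Δ t + 2 * C)
    (hz₂ : ∀ t, z₂ t = 2 * Δ t - C)
    (hrel : ∀ t : ℝ,
      8 * (r₁ ^ 2 - (z₁ t) ^ 2) * (r₂ ^ 2 - (z₂ t) ^ 2)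
        = 16 * (deriv z₁ t) ^ 2
          + (4 - (r₁ ^ 2 - (z₁ t) ^ 2) - 2 * (r₂ ^ 2 - (z₂ t) ^ 2)) ^ 2) :
    ∀ t : ℝ,
      (1 / 2) * (deriv Δ t) ^ 2
        + ((1 / 8) * (Δ t) ^ 4
          + ((-2 * C ^ 2 + r₁ ^ 2 - 2 * r₂ ^ 2 + 12) / 16) * (Δ t) ^ 2
          + (-C) * Δ t
          + ((6 * C ^ 2 - r₁ ^ 2 - 2 * r₂ ^ 2 + 4) ^ 2
              - 8 * (4 * C ^ 2 - r₁ ^ 2) * (C ^ 2 - r₂ ^ 2)) / 128) = 0 := by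
  intro t
  have hderiv : deriv z₁ t = -2 * deriv Δ t := by
    rw [funext hz₁]
    exact (((hΔ t).hasDerivAt.const_mul (-2)).add_const (2 * C)).deriv
  have h := hrel t
  rw [hderiv, hz₁ t, hz₂ t] at h
  linear_combination (-1 / 128) * h
end

section
/- Let φ : ℝ → ℝ be differentiable and let v₁, v₂ : ℝ → ℝ³ be differentiable and satisfy the phase-driven Bloch equations vₖ'(t) = √k (cos φ(t), −sin φ(t), 0) × vₖ(t) for k = 1, 2, where × denotes the cross product on ℝ³. Write vₖ = (xₖ, yₖ, zₖ) componentwise. Assume that for all t ∈ ℝ: x₁(t) + √2·x₂(t) = 0 and y₁(t) + √2·y₂(t) = 0, and that x₁(t)² + y₁(t)² > 0 for all t. Then the derivative φ' is constant on ℝ; i.e., abnormal extremals have constant detuning. -/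
open Matrix

/-- Abnormal extremals for `N = 2` two-level systems have constant detuning `Δ = φ'`. -/
theorem abnormal_constant_detuning
    (φ : ℝ → ℝ) (v₁ v₂ : ℝ → Fin 3 → ℝ)
    (hφ : Differentiable ℝ φ)
    (hv₁ : Differentiable ℝ v₁) (hv₂ : Differentiable ℝ v₂)
    (hode₁ : ∀ t : ℝ, deriv v₁ t
      = crossProduct ![Real.cos (φ t), -Real.sin (φ t), 0] (v₁ t))
    (hode₂ : ∀ t : ℝ, deriv v₂ t
      = Real.sqrt 2 • crossProduct ![Real.cos (φ t), -Real.sin (φ t), 0] (v₂ t))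
    (hx : ∀ t : ℝ, v₁ t 0 + Real.sqrt 2 * v₂ t 0 = 0)
    (hy : ∀ t : ℝ, v₁ t 1 + Real.sqrt 2 * v₂ t 1 = 0)
    (hpos : ∀ t : ℝ, (v₁ t 0) ^ 2 + (v₁ t 1) ^ 2 > 0) :
    ∃ c : ℝ, ∀ t : ℝ, deriv φ t = c := by
  have hsq : Real.sqrt 2 * Real.sqrt 2 = 2 := Real.mul_self_sqrt (by norm_num)
  have hd₁ : ∀ t i, HasDerivAt (fun u => v₁ u i)
      (crossProduct ![Real.cos (φ t), -Real.sin (φ t), 0] (v₁ t) i) t := fun t i =>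
    hasDerivAt_pi.1 (hode₁ t ▸ (hv₁ t).hasDerivAt) i
  have hd₂ : ∀ t i, HasDerivAt (fun u => v₂ u i)
      ((Real.sqrt 2 • crossProduct ![Real.cos (φ t), -Real.sin (φ t), 0] (v₂ t)) i) t :=
    fun t i => hasDerivAt_pi.1 (hode₂ t ▸ (hv₂ t).hasDerivAt) i
  have hx₁ : ∀ t, HasDerivAt (fun u => v₁ u 0) (-Real.sin (φ t) * v₁ t 2) t := fun t => by
    simpa [cross_apply] using hd₁ t 0
  have hy₁ : ∀ t, HasDerivAt (fun u => v₁ u 1) (-(Real.cos (φ t) * v₁ t 2)) t := fun t => by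
    simpa [cross_apply] using hd₁ t 1
  have hz₁ : ∀ t, HasDerivAt (fun u => v₁ u 2)
      (Real.cos (φ t) * v₁ t 1 + Real.sin (φ t) * v₁ t 0) t := fun t => by
    simpa [cross_apply] using hd₁ t 2
  have hx₂ : ∀ t, HasDerivAt (fun u => v₂ u 0)
      (Real.sqrt 2 * (-Real.sin (φ t) * v₂ t 2)) t := fun t => by
    simpa [cross_apply] using hd₂ t 0
  have hy₂ : ∀ t, HasDerivAt (fun u => v₂ u 1)
      (Real.sqrt 2 * (-(Real.cos (φ t) * v₂ t 2))) t := fun t => by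
    simpa [cross_apply] using hd₂ t 1
  have hz₂ : ∀ t, HasDerivAt (fun u => v₂ u 2)
      (Real.sqrt 2 * (Real.cos (φ t) * v₂ t 1 + Real.sin (φ t) * v₂ t 0)) t := fun t => by
    simpa [cross_apply] using hd₂ t 2
  have deriv_zero : ∀ {f : ℝ → ℝ} {f' t : ℝ}, (∀ u, f u = 0) → HasDerivAt f f' t → f' = 0 :=
    fun {f f' t} h hf => by
      obtain rfl : f = fun _ => 0 := funext h
      exact hf.unique (hasDerivAt_const t 0)
  have hz : ∀ t, v₁ t 2 + 2 * v₂ t 2 = 0 := fun t => by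
    have h0 := deriv_zero hx ((hx₁ t).add ((hx₂ t).const_mul (Real.sqrt 2)))
    have h1 := deriv_zero hy ((hy₁ t).add ((hy₂ t).const_mul (Real.sqrt 2)))
    linear_combination -Real.sin (φ t) * h0 - Real.cos (φ t) * h1
      - (v₁ t 2 + 2 * v₂ t 2) * Real.sin_sq_add_cos_sq (φ t)
      - (Real.sin (φ t) ^ 2 + Real.cos (φ t) ^ 2) * v₂ t 2 * hsq
  have hperp : ∀ t, Real.cos (φ t) * v₁ t 1 + Real.sin (φ t) * v₁ t 0 = 0 := fun t => by
    have h := deriv_zero hz ((hz₁ t).add ((hz₂ t).const_mul 2))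
    linear_combination -h + 2 * Real.cos (φ t) * hy t + 2 * Real.sin (φ t) * hx t
  have hc := fun t => (hφ t).hasDerivAt.cos
  have hs := fun t => (hφ t).hasDerivAt.sin
  have hr' : ∀ t, HasDerivAt (fun u => Real.cos (φ u) * v₁ u 0 - Real.sin (φ u) * v₁ u 1) 0 t :=
    fun t => (((hc t).mul (hx₁ t)).sub ((hs t).mul (hy₁ t))).congr_deriv (by
      linear_combination -deriv φ t * hperp t)
  have hr := is_const_of_deriv_eq_zero (fun t => (hr' t).differentiableAt) fun t => (hr' t).deriv
  have hzc := is_const_of_deriv_eq_zero (fun t => (hz₁ t).differentiableAt)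
    fun t => (hz₁ t).deriv.trans (hperp t)
  have hφr : ∀ t, deriv φ t * (Real.cos (φ t) * v₁ t 0 - Real.sin (φ t) * v₁ t 1) = v₁ t 2 :=
    fun t => by
      have h := deriv_zero hperp (((hc t).mul (hy₁ t)).add ((hs t).mul (hx₁ t)))
      linear_combination h + v₁ t 2 * Real.sin_sq_add_cos_sq (φ t)
  have hr0 : ∀ t, Real.cos (φ t) * v₁ t 0 - Real.sin (φ t) * v₁ t 1 ≠ 0 := fun t h => by
    refine (hpos t).ne' ?_
    linear_combination (Real.cos (φ t) * v₁ t 0 - Real.sin (φ t) * v₁ t 1) * h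
      + (Real.cos (φ t) * v₁ t 1 + Real.sin (φ t) * v₁ t 0) * hperp t
      - (v₁ t 0 ^ 2 + v₁ t 1 ^ 2) * Real.sin_sq_add_cos_sq (φ t)
  refine ⟨v₁ 0 2 / (Real.cos (φ 0) * v₁ 0 0 - Real.sin (φ 0) * v₁ 0 1), fun t => ?_⟩
  rw [eq_div_iff (hr0 0), ← hr t 0, hφr t, hzc t 0]
end

section
/- Let φ : ℝ → ℝ and let v₁, v₂ : ℝ → ℝ³ be differentiable and satisfy the phase-driven Bloch equations vₖ'(t) = √k (cos φ(t), −sin φ(t), 0) × vₖ(t) for k = 1, 2, where × denotes the cross product on ℝ³. Write vₖ = (xₖ, yₖ, zₖ). Assume that for all t ∈ ℝ: x₁(t) + √2·x₂(t) = 0 and y₁(t) + √2·y₂(t) = 0. Then for all t ∈ ℝ: (a) z₁(t) + 2z₂(t) = 0; (b) z₁'(t) = 0, so z₁ is constant; (c) cos φ(t)·y₁(t) + sin φ(t)·x₁(t) = 0; and (d) x₁(t)² + y₁(t)² is constant. -/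
open Matrix

/-- Coordinate form of a Bloch equation with coupling `r` and phase `φ`. -/
theorem hasDerivAt_bloch_coordinates {φ : ℝ → ℝ} {v : ℝ → Fin 3 → ℝ} {r : ℝ}
    (hv : Differentiable ℝ v)
    (hode : ∀ t : ℝ, deriv v t
      = r • crossProduct ![Real.cos (φ t), -Real.sin (φ t), 0] (v t)) (t : ℝ) :
    HasDerivAt (fun s => v s 0) (-(r * Real.sin (φ t) * v t 2)) t
    ∧ HasDerivAt (fun s => v s 1) (-(r * Real.cos (φ t) * v t 2)) t
    ∧ HasDerivAt (fun s => v s 2)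
        (r * (Real.cos (φ t) * v t 1 + Real.sin (φ t) * v t 0)) t := by
  have h := hasDerivAt_pi.1 (hode t ▸ (hv t).hasDerivAt)
  refine ⟨(h 0).congr_deriv ?_, (h 1).congr_deriv ?_, (h 2).congr_deriv ?_⟩ <;>
    simp [cross_apply] <;> ring

/-- Intermediate conserved-quantity claims for abnormal extremals with `N = 2`
two-level systems:  (a) `z₁ + 2 z₂ = 0`; (b) `z₁' = 0`, so `z₁` is constant;
(c) `cos φ · y₁ + sin φ · x₁ = 0`; (d) `x₁² + y₁²` is constant. -/
theorem abnormal_conserved_quantities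
    (φ : ℝ → ℝ) (v₁ v₂ : ℝ → Fin 3 → ℝ)
    (hv₁ : Differentiable ℝ v₁) (hv₂ : Differentiable ℝ v₂)
    (hode₁ : ∀ t : ℝ, deriv v₁ t
      = crossProduct ![Real.cos (φ t), -Real.sin (φ t), 0] (v₁ t))
    (hode₂ : ∀ t : ℝ, deriv v₂ t
      = Real.sqrt 2 • crossProduct ![Real.cos (φ t), -Real.sin (φ t), 0] (v₂ t))
    (hx : ∀ t : ℝ, v₁ t 0 + Real.sqrt 2 * v₂ t 0 = 0)
    (hy : ∀ t : ℝ, v₁ t 1 + Real.sqrt 2 * v₂ t 1 = 0) :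
    (∀ t : ℝ, v₁ t 2 + 2 * v₂ t 2 = 0)
    ∧ (∀ t : ℝ, deriv (fun s => v₁ s 2) t = 0)
    ∧ (∃ a : ℝ, ∀ t : ℝ, v₁ t 2 = a)
    ∧ (∀ t : ℝ, Real.cos (φ t) * v₁ t 1 + Real.sin (φ t) * v₁ t 0 = 0)
    ∧ (∃ b : ℝ, ∀ t : ℝ, (v₁ t 0) ^ 2 + (v₁ t 1) ^ 2 = b) := by
  have h₁ := hasDerivAt_bloch_coordinates (r := 1) hv₁ (by simpa using hode₁)
  have h₂ := hasDerivAt_bloch_coordinates hv₂ hode₂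
  have hsqrt : Real.sqrt 2 * Real.sqrt 2 = 2 := Real.mul_self_sqrt (by norm_num)
  have deriv_zero : ∀ {f : ℝ → ℝ} {f' t : ℝ}, (∀ s, f s = 0) → HasDerivAt f f' t → f' = 0 := by
    intro f f' t hf h
    obtain rfl : f = fun _ => 0 := funext hf
    exact h.unique (hasDerivAt_const t 0)
  have hz : ∀ t, v₁ t 2 + 2 * v₂ t 2 = 0 := by
    intro t
    have hdx := deriv_zero hx ((h₁ t).1.add ((h₂ t).1.const_mul (Real.sqrt 2)))
    have hdy := deriv_zero hy ((h₁ t).2.1.add ((h₂ t).2.1.const_mul (Real.sqrt 2)))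
    linear_combination (-Real.sin (φ t)) * hdx - Real.cos (φ t) * hdy
      - (v₁ t 2 + 2 * v₂ t 2) * Real.sin_sq_add_cos_sq (φ t)
      - v₂ t 2 * (Real.sin (φ t) ^ 2 + Real.cos (φ t) ^ 2) * hsqrt
  have hc : ∀ t, Real.cos (φ t) * v₁ t 1 + Real.sin (φ t) * v₁ t 0 = 0 := by
    intro t
    have hdz := deriv_zero hz ((h₁ t).2.2.add ((h₂ t).2.2.const_mul 2))
    linear_combination -hdz + 2 * Real.cos (φ t) * hy t + 2 * Real.sin (φ t) * hx t
  have hdz : ∀ t, HasDerivAt (fun s => v₁ s 2) 0 t := fun t =>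
    (h₁ t).2.2.congr_deriv (by rw [hc t, mul_zero])
  have hdr : ∀ t, HasDerivAt (fun s => v₁ s 0 ^ 2 + v₁ s 1 ^ 2) 0 t := fun t =>
    (((h₁ t).1.pow 2).add ((h₁ t).2.1.pow 2)).congr_deriv (by
      push_cast
      linear_combination (-2 * v₁ t 2) * hc t)
  refine ⟨hz, fun t => (hdz t).deriv, ⟨v₁ 0 2, fun t => ?_⟩, hc,
    ⟨v₁ 0 0 ^ 2 + v₁ 0 1 ^ 2, fun t => ?_⟩⟩
  · exact is_const_of_deriv_eq_zero (fun t => (hdz t).differentiableAt)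
      (fun t => (hdz t).deriv) t 0
  · exact is_const_of_deriv_eq_zero (fun t => (hdr t).differentiableAt)
      (fun t => (hdr t).deriv) t 0
end

section
/- Let a, b ∈ ℝ with b ≠ 0, let φ : ℝ → ℝ be differentiable, and suppose the vector-valued function v(t) = (b cos φ(t), −b sin φ(t), a) satisfies v'(t) = (cos φ(t), −sin φ(t), 0) × v(t) for all t ∈ ℝ, where × denotes the cross product on ℝ³. Then φ'(t) = a/b for all t ∈ ℝ. -/
open Matrix

/-- Auxiliary lemma for abnormal extremals: if the Bloch-type vector
`v = (b cos φ, −b sin φ, a)` satisfies `v' = (cos φ, −sin φ, 0) × v`, then the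
detuning `φ'` equals the constant `a / b`. -/
theorem abnormal_detuning_eq_div
    (a b : ℝ) (hb : b ≠ 0) (φ : ℝ → ℝ) (hφ : Differentiable ℝ φ)
    (hode : ∀ t : ℝ,
      deriv (fun s => ![b * Real.cos (φ s), -b * Real.sin (φ s), a]) t
        = crossProduct ![Real.cos (φ t), -Real.sin (φ t), 0]
            ![b * Real.cos (φ t), -b * Real.sin (φ t), a]) :
    ∀ t : ℝ, deriv φ t = a / b := by
  intro t
  have hd := (hφ t).hasDerivAt
  have hv : HasDerivAt (fun s => ![b * Real.cos (φ s), -b * Real.sin (φ s), a])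
      ![b * (-Real.sin (φ t) * deriv φ t), -b * (Real.cos (φ t) * deriv φ t), 0] t := by
    rw [hasDerivAt_pi]
    intro i
    fin_cases i
    · exact hd.cos.const_mul b
    · exact hd.sin.const_mul (-b)
    · exact hasDerivAt_const t a
  have h := hode t
  rw [hv.deriv, cross_apply] at h
  have h0 : b * (Real.sin (φ t) * deriv φ t) = Real.sin (φ t) * a := by
    simpa using congrFun h 0
  have h1 : b * (Real.cos (φ t) * deriv φ t) = Real.cos (φ t) * a := by
    simpa using congrFun h 1
  rw [eq_div_iff hb]
  linear_combination Real.sin (φ t) * h0 + Real.cos (φ t) * h1 +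
    (a - b * deriv φ t) * Real.sin_sq_add_cos_sq (φ t)
end

section
/- Let N ≥ 1, let φ : ℝ → ℝ, and let v₁, …, v_N : ℝ → ℝ³ be differentiable with vₖ'(t) = √k·(cos φ(t), −sin φ(t), 0) × vₖ(t) for all k and t, where × is the cross product on ℝ³. Write vₖ = (xₖ, yₖ, zₖ). Assume the phase constraint holds for all t: cos φ(t) = (1/2)·Σ_{k=1}^N √k·xₖ(t) and sin φ(t) = −(1/2)·Σ_{k=1}^N √k·yₖ(t). Then C(t) := Σ_{k=1}^N zₖ(t) is constant in t. -/
open Matrix Finset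

/-- Conserved quantity `C = Σₖ vₖ^(z)` for normal extremals of the `N`-qubit
Rydberg blockade control problem, under the PMP phase constraint. -/
theorem sum_z_conserved
    (N : ℕ) (hN : 1 ≤ N) (φ : ℝ → ℝ)
    (v : Fin N → ℝ → Fin 3 → ℝ)
    (hv : ∀ k : Fin N, Differentiable ℝ (v k))
    (hode : ∀ (k : Fin N) (t : ℝ), deriv (v k) t
      = Real.sqrt ((k : ℕ) + 1) •
          crossProduct ![Real.cos (φ t), -Real.sin (φ t), 0] (v k t))
    (hcos : ∀ t : ℝ, Real.cos (φ t)
      = (1 / 2) * ∑ k : Fin N, Real.sqrt ((k : ℕ) + 1) * v k t 0)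
    (hsin : ∀ t : ℝ, Real.sin (φ t)
      = -(1 / 2) * ∑ k : Fin N, Real.sqrt ((k : ℕ) + 1) * v k t 1) :
    ∃ c : ℝ, ∀ t : ℝ, ∑ k : Fin N, v k t 2 = c := by
  have hz : ∀ t, HasDerivAt (fun t => ∑ k : Fin N, v k t 2) 0 t := by
    intro t
    have hk : ∀ k ∈ (Finset.univ : Finset (Fin N)), HasDerivAt (fun t => v k t 2)
        (Real.cos (φ t) * (Real.sqrt ((k : ℕ) + 1) * v k t 1)
          + Real.sin (φ t) * (Real.sqrt ((k : ℕ) + 1) * v k t 0)) t := by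
      intro k _
      refine (hasDerivAt_pi.1 (hv k t).hasDerivAt 2).congr_deriv ?_
      rw [hode, cross_apply]
      simp
      ring
    refine (HasDerivAt.fun_sum hk).congr_deriv ?_
    rw [Finset.sum_add_distrib, ← Finset.mul_sum, ← Finset.mul_sum]
    linear_combination 2 * Real.cos (φ t) * hsin t - 2 * Real.sin (φ t) * hcos t
  exact ⟨∑ k : Fin N, v k 0 2, fun t =>
    is_const_of_deriv_eq_zero (fun t => (hz t).differentiableAt) (fun t => (hz t).deriv) t 0⟩
end

section
/- Let N ≥ 1, let φ : ℝ → ℝ be differentiable, and let v₁, …, v_N : ℝ → ℝ³ be differentiable with vₖ'(t) = √k·(cos φ(t), −sin φ(t), 0) × vₖ(t) for all k and t, where × is the cross product on ℝ³. Write vₖ = (xₖ, yₖ, zₖ). Assume the phase constraint holds for all t: cos φ(t) = (1/2)·Σ_{k=1}^N √k·xₖ(t) and sin φ(t) = −(1/2)·Σ_{k=1}^N √k·yₖ(t). Then the detuning satisfies φ'(t) = (1/2)·Σ_{k=1}^N k·zₖ(t) for all t. -/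
open Matrix Finset

/-- Detuning formula `Δ = φ' = (1/2) Σₖ k vₖ^(z)` for normal extremals of the
`N`-qubit Rydberg blockade control problem, under the PMP phase constraint. -/
theorem detuning_formula
    (N : ℕ) (hN : 1 ≤ N) (φ : ℝ → ℝ) (hφ : Differentiable ℝ φ)
    (v : Fin N → ℝ → Fin 3 → ℝ)
    (hv : ∀ k : Fin N, Differentiable ℝ (v k))
    (hode : ∀ (k : Fin N) (t : ℝ), deriv (v k) t
      = Real.sqrt ((k : ℕ) + 1) •
          crossProduct ![Real.cos (φ t), -Real.sin (φ t), 0] (v k t))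
    (hcos : ∀ t : ℝ, Real.cos (φ t)
      = (1 / 2) * ∑ k : Fin N, Real.sqrt ((k : ℕ) + 1) * v k t 0)
    (hsin : ∀ t : ℝ, Real.sin (φ t)
      = -(1 / 2) * ∑ k : Fin N, Real.sqrt ((k : ℕ) + 1) * v k t 1) :
    ∀ t : ℝ, deriv φ t = (1 / 2) * ∑ k : Fin N, ((k : ℕ) + 1 : ℝ) * v k t 2 := by
  intro t
  set S : ℝ := (1 / 2) * ∑ k : Fin N, ((k : ℕ) + 1 : ℝ) * v k t 2 with hS
  have hcoord : ∀ (k : Fin N) (i : Fin 3),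
      HasDerivAt (fun s => v k s i) (deriv (v k) t i) t := fun k i =>
    hasDerivAt_pi.1 (hv k t).hasDerivAt i
  have hx : ∀ k : Fin N, HasDerivAt (fun s => Real.sqrt ((k : ℕ) + 1) * v k s 0)
      (-Real.sin (φ t) * (((k : ℕ) + 1 : ℝ) * v k t 2)) t := fun k => by
    refine ((hcoord k 0).const_mul _).congr_deriv ?_
    have hsq : Real.sqrt ((k : ℕ) + 1) * Real.sqrt ((k : ℕ) + 1) = ((k : ℕ) + 1 : ℝ) :=
      Real.mul_self_sqrt (by positivity)
    rw [hode, ← hsq]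
    simp [cross_apply]
    ring
  have hy : ∀ k : Fin N, HasDerivAt (fun s => Real.sqrt ((k : ℕ) + 1) * v k s 1)
      (-Real.cos (φ t) * (((k : ℕ) + 1 : ℝ) * v k t 2)) t := fun k => by
    refine ((hcoord k 1).const_mul _).congr_deriv ?_
    have hsq : Real.sqrt ((k : ℕ) + 1) * Real.sqrt ((k : ℕ) + 1) = ((k : ℕ) + 1 : ℝ) :=
      Real.mul_self_sqrt (by positivity)
    rw [hode, ← hsq]
    simp [cross_apply]
    ring
  have hcos' : -Real.sin (φ t) * deriv φ t = -Real.sin (φ t) * S := by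
    have h := (HasDerivAt.fun_sum (u := Finset.univ) fun k _ => hx k).const_mul (1 / 2 : ℝ)
    rw [← funext hcos, ← Finset.mul_sum] at h
    rw [(hφ t).hasDerivAt.cos.unique h, hS]
    ring
  have hsin' : Real.cos (φ t) * deriv φ t = Real.cos (φ t) * S := by
    have h := (HasDerivAt.fun_sum (u := Finset.univ) fun k _ => hy k).const_mul (-(1 / 2) : ℝ)
    rw [← funext hsin, ← Finset.mul_sum] at h
    rw [(hφ t).hasDerivAt.sin.unique h, hS]
    ring
  linear_combination Real.cos (φ t) * hsin' - Real.sin (φ t) * hcos' -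
    (deriv φ t - S) * Real.sin_sq_add_cos_sq (φ t)
end

section
/- Let φ : ℝ → ℝ and let v₁, v₂ : ℝ → ℝ³ be differentiable with vₖ'(t) = √k·(cos φ(t), −sin φ(t), 0) × vₖ(t) for k = 1, 2 and all t, where × is the cross product on ℝ³. Write vₖ = (xₖ, yₖ, zₖ). Assume the phase constraint holds for all t: cos φ = (1/2)(x₁ + √2·x₂) and sin φ = −(1/2)(y₁ + √2·y₂). Then for all t: 8·(‖v₁‖² − z₁²)·(‖v₂‖² − z₂²) = 16·(z₁'(t))² + (4 − (‖v₁‖² − z₁²) − 2·(‖v₂‖² − z₂²))², where ‖·‖ is the Euclidean norm on ℝ³. -/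
open Matrix

/-- Equation (wcjkw): along normal extremals of the two-qubit Rydberg blockade
control problem, with `‖vₖ‖` the Euclidean norm and `zₖ = vₖ^(z)`,
`8(‖v₁‖² − z₁²)(‖v₂‖² − z₂²) = 16 (z₁')² + (4 − (‖v₁‖² − z₁²) − 2(‖v₂‖² − z₂²))²`. -/
theorem wcjkw_relation
    (φ : ℝ → ℝ) (v₁ v₂ : ℝ → Fin 3 → ℝ)
    (hv₁ : Differentiable ℝ v₁) (hv₂ : Differentiable ℝ v₂)
    (hode₁ : ∀ t : ℝ, deriv v₁ t
      = crossProduct ![Real.cos (φ t), -Real.sin (φ t), 0] (v₁ t))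
    (hode₂ : ∀ t : ℝ, deriv v₂ t
      = Real.sqrt 2 • crossProduct ![Real.cos (φ t), -Real.sin (φ t), 0] (v₂ t))
    (hcos : ∀ t : ℝ, Real.cos (φ t) = (1 / 2) * (v₁ t 0 + Real.sqrt 2 * v₂ t 0))
    (hsin : ∀ t : ℝ, Real.sin (φ t) = -(1 / 2) * (v₁ t 1 + Real.sqrt 2 * v₂ t 1)) :
    ∀ t : ℝ,
      8 * (((v₁ t 0) ^ 2 + (v₁ t 1) ^ 2 + (v₁ t 2) ^ 2) - (v₁ t 2) ^ 2)
        * (((v₂ t 0) ^ 2 + (v₂ t 1) ^ 2 + (v₂ t 2) ^ 2) - (v₂ t 2) ^ 2)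
      = 16 * (deriv (fun s => v₁ s 2) t) ^ 2
        + (4 - (((v₁ t 0) ^ 2 + (v₁ t 1) ^ 2 + (v₁ t 2) ^ 2) - (v₁ t 2) ^ 2)
            - 2 * (((v₂ t 0) ^ 2 + (v₂ t 1) ^ 2 + (v₂ t 2) ^ 2) - (v₂ t 2) ^ 2)) ^ 2 := by
  intro t
  have hz : deriv (fun s => v₁ s 2) t
      = Real.sqrt 2 / 2 * (v₂ t 0 * v₁ t 1 - v₂ t 1 * v₁ t 0) := by
    have h := congrFun (hode₁ t) 2
    rw [deriv_pi (differentiableAt_pi.1 (hv₁ t))] at h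
    refine h.trans ?_
    simp only [cross_apply, hcos, hsin]
    simp
    ring
  have hs : Real.sqrt 2 ^ 2 = 2 := Real.sq_sqrt (by norm_num)
  have hdot : 4 - (v₁ t 0 ^ 2 + v₁ t 1 ^ 2) - 2 * (v₂ t 0 ^ 2 + v₂ t 1 ^ 2)
      = 2 * Real.sqrt 2 * (v₁ t 0 * v₂ t 0 + v₁ t 1 * v₂ t 1) := by
    have h := Real.sin_sq_add_cos_sq (φ t)
    rw [hcos, hsin] at h
    linear_combination (-4) * h + (v₂ t 0 ^ 2 + v₂ t 1 ^ 2) * hs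
  rw [hz, add_sub_cancel_right, add_sub_cancel_right, hdot]
  linear_combination (-4 * (v₂ t 0 * v₁ t 1 - v₂ t 1 * v₁ t 0) ^ 2
    - 4 * (v₁ t 0 * v₂ t 0 + v₁ t 1 * v₂ t 1) ^ 2) * hs
end
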